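/- Let S be any finite generating set of Thompson's group T. There exists a constant C > 0 such that for all sufficiently large n there exist conjugate elements u, v of T with ℓ_S(u) + ℓ_S(v) ≤ n such that every h ∈ T with h⁻¹uh = v satisfies ℓ_S(h) ≥ C·n². In particular the conjugator length function of T (with respect to S) satisfies CLF(n) ≥ C·n² for all sufficiently large n. -/

import Mathlib

noncomputable section

open Set

noncomputable section

open Set

def x0fun : ℝ → ℝ := fun t =>
  if t < 0 then t
  else if t ≤ 1/2 then t / 2
  else if t ≤ 3/4 then t - 1/4
  else if t ≤ 1 then 2 * t - 1
  else t

def x0inv : ℝ → ℝ := fun t =>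
  if t < 0 then t
  else if t ≤ 1/4 then 2 * t
  else if t ≤ 1/2 then t + 1/4
  else if t ≤ 1 then (t + 1) / 2
  else t

/-- The generator `x₀` of Thompson's group `F`, as a permutation of `ℝ`
(the identity outside `[0,1]`). -/
def x0 : Equiv.Perm ℝ where
  toFun := x0fun
  invFun := x0inv
  left_inv := by
    intro t
    show x0inv (x0fun t) = t
    unfold x0fun
    split_ifs <;> (unfold x0inv; split_ifs <;> linarith)
  right_inv := by
    intro t
    show x0fun (x0inv t) = t
    unfold x0inv
    split_ifs <;> (unfold x0fun; split_ifs <;> linarith)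

def x1fun : ℝ → ℝ := fun t =>
  if t < 0 then t
  else if t ≤ 1/2 then t
  else if t ≤ 3/4 then t / 2 + 1/4
  else if t ≤ 7/8 then t - 1/8
  else if t ≤ 1 then 2 * t - 1
  else t

def x1inv : ℝ → ℝ := fun t =>
  if t < 0 then t
  else if t ≤ 1/2 then t
  else if t ≤ 5/8 then 2 * t - 1/2
  else if t ≤ 3/4 then t + 1/8
  else if t ≤ 1 then (t + 1) / 2
  else t

set_option maxHeartbeats 2000000 in
/-- The generator `x₁` of Thompson's group `F`, as a permutation of `ℝ`
(the identity outside `[0,1]`). -/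
def x1 : Equiv.Perm ℝ where
  toFun := x1fun
  invFun := x1inv
  left_inv := by
    intro t
    show x1inv (x1fun t) = t
    unfold x1fun
    split_ifs <;> (unfold x1inv; split_ifs <;> linarith)
  right_inv := by
    intro t
    show x1fun (x1inv t) = t
    unfold x1inv
    split_ifs <;> (unfold x1fun; split_ifs <;> linarith)

/-- Thompson's group `F`: the subgroup generated by `x₀` and `x₁`. -/
def ThompsonF : Subgroup (Equiv.Perm ℝ) :=
  Subgroup.closure ({x0, x1} : Set (Equiv.Perm ℝ))

/-- Word length with respect to the generating set `{x₀, x₁}`. -/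
def wordLength (f : Equiv.Perm ℝ) : ℕ :=
  sInf {n | ∃ w : List (Equiv.Perm ℝ), w.length = n ∧
    (∀ g ∈ w, g ∈ ({x0, x1, x0⁻¹, x1⁻¹} : Set (Equiv.Perm ℝ))) ∧ w.prod = f}
/-- `a` and `b` are the endpoints of a standard dyadic interval `[k/2^m, (k+1)/2^m]`. -/
def IsStdDyadicPair (a b : ℝ) : Prop :=
  ∃ k m : ℕ, a = (k : ℝ) / 2 ^ m ∧ b = ((k : ℝ) + 1) / 2 ^ m

/-- Membership in Thompson's group `V`, realized as permutations of `ℝ` that are the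
identity outside `[0,1)`: there are partitions of `[0,1)` into standard dyadic intervals
`[a_{i−1}, a_i)` and `[b_{i−1}, b_i)` and a permutation `σ` such that `v` maps
`[a_{i−1}, a_i)` onto `[b_{σ(i)−1}, b_{σ(i)})` by an increasing affine map. -/
def MemV (v : Equiv.Perm ℝ) : Prop :=
  (∀ t, t ∉ Set.Ico (0:ℝ) 1 → v t = t) ∧
  ∃ N : ℕ, ∃ a b : Fin (N + 1) → ℝ, ∃ σ : Equiv.Perm (Fin N),
    a 0 = 0 ∧ a (Fin.last N) = 1 ∧ b 0 = 0 ∧ b (Fin.last N) = 1 ∧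
    StrictMono a ∧ StrictMono b ∧
    ∀ i : Fin N, IsStdDyadicPair (a i.castSucc) (a i.succ) ∧
      IsStdDyadicPair (b i.castSucc) (b i.succ) ∧
      ∃ c d : ℝ, 0 < c ∧
        (∀ t ∈ Set.Ico (a i.castSucc) (a i.succ), v t = c * t + d) ∧
        c * a i.castSucc + d = b (σ i).castSucc ∧ c * a i.succ + d = b (σ i).succ

/-- Word length with respect to a set `S` (products of elements of `S ∪ S⁻¹`). -/
def wordLengthWith (S : Set (Equiv.Perm ℝ)) (v : Equiv.Perm ℝ) : ℕ :=
  sInf {n | ∃ w : List (Equiv.Perm ℝ), w.length = n ∧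
    (∀ g ∈ w, g ∈ S ∨ g⁻¹ ∈ S) ∧ w.prod = v}

/-- `x, y, z` are in (strict) cyclic order. -/
def CycOrd (x y z : ℝ) : Prop :=
  (x < y ∧ y < z) ∨ (y < z ∧ z < x) ∨ (z < x ∧ x < y)

/-- Membership in Thompson's group `T`: elements of `V` preserving the cyclic order
on `[0,1)`. -/
def MemT (v : Equiv.Perm ℝ) : Prop :=
  MemV v ∧ ∀ x y z : ℝ, x ∈ Set.Ico (0:ℝ) 1 → y ∈ Set.Ico (0:ℝ) 1 → z ∈ Set.Ico (0:ℝ) 1 →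
    CycOrd x y z → CycOrd (v x) (v y) (v z)

/-- `S` is a finite generating set of Thompson's group `T`. -/
def GeneratesT (S : Set (Equiv.Perm ℝ)) : Prop :=
  S.Finite ∧ (∀ s ∈ S, MemT s) ∧
  ∀ v, MemT v → ∃ w : List (Equiv.Perm ℝ), (∀ g ∈ w, g ∈ S ∨ g⁻¹ ∈ S) ∧ w.prod = v

/-- Conjugator distance in `T` with respect to the generating set `S`. -/
def conjDistT (S : Set (Equiv.Perm ℝ)) (u v : Equiv.Perm ℝ) : ℕ :=
  sInf {n | ∃ h, MemT h ∧ h⁻¹ * u * h = v ∧ wordLengthWith S h = n}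

/-- The conjugator length function of `T` with respect to the generating set `S`. -/
def CLFT (S : Set (Equiv.Perm ℝ)) (n : ℕ) : ℕ :=
  sSup {m | ∃ u v, MemT u ∧ MemT v ∧ (∃ h, MemT h ∧ h⁻¹ * u * h = v) ∧
    wordLengthWith S u + wordLengthWith S v ≤ n ∧ conjDistT S u v = m}


/-! ### A composition-friendly description of elements of `F` -/

/-- `v` maps the level `m` standard dyadic interval with index `k` affinely onto the
level `m'` standard dyadic interval with index `k'`. -/
def MapsDyadic (v : Equiv.Perm ℝ) (k m k' m' : ℕ) : Prop :=
  ∀ t ∈ Set.Icc ((k : ℝ) / 2 ^ m) (((k : ℝ) + 1) / 2 ^ m),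
    v t = ((k' : ℝ) + (2 ^ m * t - k)) / 2 ^ m'

/-- Increasing permutations supported in `(0,1)` that map every standard dyadic interval of
some fixed level affinely onto a standard dyadic interval. -/
def MemF (v : Equiv.Perm ℝ) : Prop :=
  (∀ t, t ≤ 0 ∨ 1 ≤ t → v t = t) ∧ StrictMono v ∧
    ∃ m : ℕ, ∀ k < 2 ^ m, ∃ k' m' : ℕ, MapsDyadic v k m k' m'

lemma MapsDyadic.refine {v : Equiv.Perm ℝ} {k m k' m' : ℕ} (h : MapsDyadic v k m k' m')
    (l : ℕ) {r : ℕ} (hr : r < 2 ^ l) :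
    MapsDyadic v (k * 2 ^ l + r) (m + l) (k' * 2 ^ l + r) (m' + l) := by
  intro t ht
  obtain ⟨h1, h2⟩ := ht
  have hm : (0 : ℝ) < 2 ^ m := by positivity
  have hl : (0 : ℝ) < 2 ^ l := by positivity
  have hm' : (0 : ℝ) < 2 ^ m' := by positivity
  have hr' : (r : ℝ) + 1 ≤ 2 ^ l := by exact_mod_cast hr
  have hr0 : (0 : ℝ) ≤ r := by positivity
  rw [pow_add, div_le_iff₀ (by positivity)] at h1
  rw [pow_add, le_div_iff₀ (by positivity)] at h2
  push_cast at h1 h2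
  rw [h t ⟨?_, ?_⟩]
  · push_cast
    rw [pow_add, pow_add]
    field_simp
    ring
  · rw [div_le_iff₀ hm]
    by_contra hc
    nlinarith
  · rw [le_div_iff₀ hm]
    by_contra hc
    nlinarith

lemma MapsDyadic.comp {g h : Equiv.Perm ℝ} {k m k' m' k'' m'' : ℕ}
    (hg : MapsDyadic g k' m' k'' m'') (hh : MapsDyadic h k m k' m') :
    MapsDyadic (g * h) k m k'' m'' := by
  intro t ht
  have e := hh t ht
  obtain ⟨h1, h2⟩ := ht
  have hm : (0 : ℝ) < 2 ^ m := by positivity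
  have hm' : (0 : ℝ) < 2 ^ m' := by positivity
  rw [div_le_iff₀ hm] at h1
  rw [le_div_iff₀ hm] at h2
  rw [Equiv.Perm.mul_apply, e, hg _ ⟨?_, ?_⟩]
  · field_simp
    ring
  · gcongr
    linarith
  · gcongr
    linarith

lemma MemF.mul {g h : Equiv.Perm ℝ} (hg : MemF g) (hh : MemF h) : MemF (g * h) := by
  obtain ⟨g0, gm, m₁, g1⟩ := hg
  obtain ⟨h0, hm, m₂, h1⟩ := hh
  refine ⟨fun t ht => by rw [Equiv.Perm.mul_apply, h0 t ht, g0 t ht], gm.comp hm, m₂ + m₁, ?_⟩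
  intro K hK
  have hk : K / 2 ^ m₁ < 2 ^ m₂ := by
    rw [Nat.div_lt_iff_lt_mul (by positivity), ← pow_add]
    exact hK
  obtain ⟨k', m', hk'⟩ := h1 _ hk
  have hsub := hk'.refine m₁ (Nat.mod_lt K (by positivity : 0 < 2 ^ m₁))
  rw [Nat.div_add_mod'] at hsub
  set K' := k' * 2 ^ m₁ + K % 2 ^ m₁ with hK'
  have hlt : K' < 2 ^ (m' + m₁) := by
    have e := hsub ((K : ℝ) / 2 ^ (m₂ + m₁)) ⟨le_rfl, by gcongr; linarith⟩
    have : (K : ℝ) / 2 ^ (m₂ + m₁) < 1 := by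
      rw [div_lt_one (by positivity)]
      exact_mod_cast hK
    have := hm this
    rw [h0 1 (Or.inr le_rfl), e, div_lt_one (by positivity),
      mul_div_cancel₀ _ (by positivity)] at this
    rw [sub_self, add_zero] at this
    exact_mod_cast this
  have hj : K' / 2 ^ m' < 2 ^ m₁ := by
    rw [Nat.div_lt_iff_lt_mul (by positivity), ← pow_add, add_comm m₁]
    exact hlt
  obtain ⟨j', n', hj'⟩ := g1 _ hj
  have hsub' := hj'.refine m' (Nat.mod_lt K' (by positivity : 0 < 2 ^ m'))
  rw [Nat.div_add_mod', add_comm m₁] at hsub'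
  exact ⟨_, _, hsub'.comp hsub⟩

lemma MemF.one : MemF 1 :=
  ⟨fun _ _ => rfl, strictMono_id, 0, fun k _ => ⟨k, 0, fun t _ => by simp⟩⟩

lemma MemF.pow {g : Equiv.Perm ℝ} (hg : MemF g) (n : ℕ) : MemF (g ^ n) := by
  induction n with
  | zero => exact MemF.one
  | succ n ih => rw [pow_succ]; exact ih.mul hg

lemma MemF.memT {v : Equiv.Perm ℝ} (hv : MemF v) : MemT v := by
  obtain ⟨h0, hm, m, h1⟩ := hv
  have hpos : (0 : ℝ) < 2 ^ m := by positivity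
  have ha : StrictMono (fun i : Fin (2 ^ m + 1) => (i : ℝ) / 2 ^ m) := by
    intro i j hij
    have : ((i : ℕ) : ℝ) < (j : ℕ) := by exact_mod_cast hij
    dsimp only
    gcongr
  refine ⟨⟨?_, 2 ^ m, fun i => (i : ℝ) / 2 ^ m, fun i => v ((i : ℝ) / 2 ^ m), 1,
    by simp, by simp, by simp [h0], by simp [h0], ha, hm.comp ha, ?_⟩, ?_⟩
  · intro t ht
    refine h0 t ?_
    by_contra hc
    push Not at hc
    exact ht ⟨hc.1.le, hc.2⟩
  · intro i
    obtain ⟨k', m', hk⟩ := h1 i i.2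
    have hpos' : (0 : ℝ) < 2 ^ m' := by positivity
    have hle : ((i : ℕ) : ℝ) / 2 ^ m ≤ (((i : ℕ) : ℝ) + 1) / 2 ^ m := by gcongr; linarith
    have e1 := hk _ ⟨le_rfl, hle⟩
    have e2 := hk _ ⟨hle, le_rfl⟩
    rw [mul_div_cancel₀ _ hpos.ne'] at e1 e2
    simp only [Fin.val_castSucc, Fin.val_succ, Nat.cast_add, Nat.cast_one,
      Equiv.Perm.one_apply]
    rw [e1, e2]
    refine ⟨⟨i, m, rfl, rfl⟩, ⟨k', m', by ring, by ring⟩,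
      2 ^ m / 2 ^ m', ((k' : ℝ) - (i : ℕ)) / 2 ^ m', by positivity, ?_, ?_, ?_⟩
    · intro t ht
      rw [hk t ⟨ht.1, ht.2.le⟩]
      field_simp
      ring
    · field_simp
      ring
    · field_simp
      ring
  · rintro x y z - - - (h | h | h)
    · exact Or.inl ⟨hm h.1, hm h.2⟩
    · exact Or.inr (Or.inl ⟨hm h.1, hm h.2⟩)
    · exact Or.inr (Or.inr ⟨hm h.1, hm h.2⟩)

/-! ### The elements `x₀` and its copy supported in `[1/2, 3/4]` -/

lemma x0_apply (t : ℝ) : x0 t = x0fun t := rfl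

lemma x0_inv_apply (t : ℝ) : x0⁻¹ t = x0inv t := rfl

lemma x0_strictMono : StrictMono x0 := by
  intro s t h
  simp only [x0_apply, x0fun]
  split_ifs <;> linarith

lemma strictMono_perm_inv {g : Equiv.Perm ℝ} (hg : StrictMono g) :
    StrictMono (g⁻¹ : Equiv.Perm ℝ) := by
  intro s t h
  rw [← hg.lt_iff_lt]
  simpa using h

lemma memF_x0 : MemF x0 := by
  refine ⟨?_, x0_strictMono, 2, ?_⟩
  · rintro t (h | h) <;> simp only [x0_apply, x0fun] <;> split_ifs <;> linarith
  · intro k hk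
    interval_cases k
    · exact ⟨0, 3, fun t ht => by
        norm_num at ht; simp only [x0_apply, x0fun]; split_ifs <;> norm_num <;> linarith⟩
    · exact ⟨1, 3, fun t ht => by
        norm_num at ht; simp only [x0_apply, x0fun]; split_ifs <;> norm_num <;> linarith⟩
    · exact ⟨1, 2, fun t ht => by
        norm_num at ht; simp only [x0_apply, x0fun]; split_ifs <;> norm_num <;> linarith⟩
    · exact ⟨1, 1, fun t ht => by
        norm_num at ht; simp only [x0_apply, x0fun]; split_ifs <;> norm_num <;> linarith⟩

lemma memF_x0_inv : MemF x0⁻¹ := by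
  refine ⟨?_, strictMono_perm_inv x0_strictMono, 2, ?_⟩
  · rintro t (h | h) <;> simp only [x0_inv_apply, x0inv] <;> split_ifs <;> linarith
  · intro k hk
    interval_cases k
    · exact ⟨0, 1, fun t ht => by
        norm_num at ht; simp only [x0_inv_apply, x0inv]; split_ifs <;> norm_num <;> linarith⟩
    · exact ⟨2, 2, fun t ht => by
        norm_num at ht; simp only [x0_inv_apply, x0inv]; split_ifs <;> norm_num <;> linarith⟩
    · exact ⟨6, 3, fun t ht => by
        norm_num at ht; simp only [x0_inv_apply, x0inv]; split_ifs <;> norm_num <;> linarith⟩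
    · exact ⟨7, 3, fun t ht => by
        norm_num at ht; simp only [x0_inv_apply, x0inv]; split_ifs <;> norm_num <;> linarith⟩

/-- The affine map of `ℝ` taking `[0,1]` onto `[1/2, 3/4]`. -/
def shrink : Equiv.Perm ℝ where
  toFun y := 1 / 2 + y / 4
  invFun t := 4 * t - 2
  left_inv y := by ring
  right_inv t := by ring

lemma shrink_apply (y : ℝ) : shrink y = 1 / 2 + y / 4 := rfl

/-- The copy of a permutation of `[0,1]` acting on `[1/2, 3/4]`. -/
def shrinkConj (g : Equiv.Perm ℝ) : Equiv.Perm ℝ := shrink * g * shrink⁻¹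

lemma shrinkConj_apply (g : Equiv.Perm ℝ) (t : ℝ) :
    shrinkConj g t = 1 / 2 + g (4 * t - 2) / 4 := rfl

lemma shrinkConj_inv (g : Equiv.Perm ℝ) : shrinkConj g⁻¹ = (shrinkConj g)⁻¹ := by
  simp [shrinkConj, mul_assoc]

lemma shrinkConj_pow (g : Equiv.Perm ℝ) (n : ℕ) : shrinkConj g ^ n = shrinkConj (g ^ n) :=
  conj_pow

lemma MemF.shrinkConj {g : Equiv.Perm ℝ} (hg : MemF g) : MemF (shrinkConj g) := by
  obtain ⟨h0, hm, m, h1⟩ := hg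
  refine ⟨fun t ht => ?_, fun s t h => ?_, m + 2, fun K hK => ?_⟩
  · rw [shrinkConj_apply, h0]
    · ring
    · rcases ht with h | h
      · left; linarith
      · right; linarith
  · rw [shrinkConj_apply, shrinkConj_apply]
    have := hm (by linarith : 4 * s - 2 < 4 * t - 2)
    linarith
  · have hpos : (0 : ℝ) < 2 ^ m := by positivity
    by_cases hin : 2 * 2 ^ m ≤ K ∧ K < 3 * 2 ^ m
    · obtain ⟨k, rfl⟩ := Nat.exists_eq_add_of_le hin.1
      obtain ⟨k', m', hk⟩ := h1 k (by omega)
      refine ⟨2 * 2 ^ m' + k', m' + 2, fun t ht => ?_⟩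
      obtain ⟨ht1, ht2⟩ := ht
      rw [div_le_iff₀ (by positivity), pow_add] at ht1
      rw [le_div_iff₀ (by positivity), pow_add] at ht2
      push_cast at ht1 ht2
      rw [shrinkConj_apply, hk _ ⟨?_, ?_⟩]
      · push_cast
        rw [pow_add, pow_add]
        field_simp
        ring
      · rw [div_le_iff₀ hpos]; linarith
      · rw [le_div_iff₀ hpos]; linarith
    · refine ⟨K, m + 2, fun t ht => ?_⟩
      obtain ⟨ht1, ht2⟩ := ht
      rw [div_le_iff₀ (by positivity), pow_add] at ht1
      rw [le_div_iff₀ (by positivity), pow_add] at ht2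
      rw [shrinkConj_apply, h0]
      · field_simp
        ring
      · rw [not_and_or, not_le, not_lt] at hin
        rcases hin with h | h
        · left
          have : (K : ℝ) + 1 ≤ 2 * 2 ^ m := by exact_mod_cast h
          by_contra hc
          nlinarith
        · right
          have : (3 : ℝ) * 2 ^ m ≤ K := by exact_mod_cast h
          by_contra hc
          nlinarith

lemma MemF.shrinkConj_apply_of_le {g : Equiv.Perm ℝ} (hg : MemF g) {t : ℝ}
    (ht : t ≤ 1 / 2 ∨ 3 / 4 ≤ t) : _root_.shrinkConj g t = t := by
  rw [_root_.shrinkConj_apply, hg.1]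
  · ring
  · rcases ht with h | h
    · left; linarith
    · right; linarith

/-! ### One-sided derivatives of `x₀` and its powers -/

lemma hasDerivWithinAt_Iic_of_affine {g : ℝ → ℝ} {c d l t : ℝ} (hl : l < t)
    (h : ∀ s ∈ Set.Ioc l t, g s = c * s + d) : HasDerivWithinAt g c (Set.Iic t) t := by
  have hd : HasDerivWithinAt (fun s => c * s + d) c (Set.Iic t) t := by
    simpa using (((hasDerivAt_id t).const_mul c).add_const d).hasDerivWithinAt
  refine hd.congr_of_eventuallyEq ?_ (h t ⟨hl, le_rfl⟩)
  filter_upwards [Ioc_mem_nhdsLE hl] with s hs using h s hs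

lemma hasDerivWithinAt_Ici_of_affine {g : ℝ → ℝ} {c d r t : ℝ} (hr : t < r)
    (h : ∀ s ∈ Set.Ico t r, g s = c * s + d) : HasDerivWithinAt g c (Set.Ici t) t := by
  have hd : HasDerivWithinAt (fun s => c * s + d) c (Set.Ici t) t := by
    simpa using (((hasDerivAt_id t).const_mul c).add_const d).hasDerivWithinAt
  refine hd.congr_of_eventuallyEq ?_ (h t ⟨le_rfl, hr⟩)
  filter_upwards [Ico_mem_nhdsGE hr] with s hs using h s hs

lemma differentiableAt_of_affine {g : ℝ → ℝ} {c d l r t : ℝ} (hl : l < t) (hr : t < r)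
    (h : ∀ s ∈ Set.Ioo l r, g s = c * s + d) : DifferentiableAt ℝ g t := by
  have hd : DifferentiableAt ℝ (fun s => c * s + d) t := by fun_prop
  refine hd.congr_of_eventuallyEq ?_
  filter_upwards [Ioo_mem_nhds hl hr] with s hs using h s hs

lemma x0_hasDerivWithinAt_Iic {t : ℝ} (h0 : 0 < t) (h1 : t < 1) :
    HasDerivWithinAt x0 (if t ≤ 1 / 2 then 1 / 2 else if t ≤ 3 / 4 then 1 else 2)
      (Set.Iic t) t := by
  split_ifs with h2 h3
  · refine hasDerivWithinAt_Iic_of_affine (d := 0) h0 fun s hs => ?_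
    obtain ⟨hs1, hs2⟩ := hs
    simp only [x0_apply, x0fun]
    split_ifs <;> linarith
  · refine hasDerivWithinAt_Iic_of_affine (l := 1 / 2) (d := -1 / 4) (by linarith) fun s hs => ?_
    obtain ⟨hs1, hs2⟩ := hs
    simp only [x0_apply, x0fun]
    split_ifs <;> linarith
  · refine hasDerivWithinAt_Iic_of_affine (l := 3 / 4) (d := -1) (by linarith) fun s hs => ?_
    obtain ⟨hs1, hs2⟩ := hs
    simp only [x0_apply, x0fun]
    split_ifs <;> linarith

lemma x0_hasDerivWithinAt_Ici {t : ℝ} (h0 : 0 < t) (h1 : t < 1) :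
    HasDerivWithinAt x0 (if t < 1 / 2 then 1 / 2 else if t < 3 / 4 then 1 else 2)
      (Set.Ici t) t := by
  split_ifs with h2 h3
  · refine hasDerivWithinAt_Ici_of_affine (d := 0) h2 fun s hs => ?_
    obtain ⟨hs1, hs2⟩ := hs
    simp only [x0_apply, x0fun]
    split_ifs <;> linarith
  · refine hasDerivWithinAt_Ici_of_affine (d := -1 / 4) h3 fun s hs => ?_
    obtain ⟨hs1, hs2⟩ := hs
    simp only [x0_apply, x0fun]
    split_ifs <;> linarith
  · refine hasDerivWithinAt_Ici_of_affine (d := -1) h1 fun s hs => ?_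
    obtain ⟨hs1, hs2⟩ := hs
    simp only [x0_apply, x0fun]
    split_ifs <;> linarith

lemma MemF.mem_Ioo {g : Equiv.Perm ℝ} (hg : MemF g) {t : ℝ} (ht : t ∈ Set.Ioo (0 : ℝ) 1) :
    g t ∈ Set.Ioo (0 : ℝ) 1 := by
  have h0 := hg.2.1 ht.1
  have h1 := hg.2.1 ht.2
  rw [hg.1 0 (Or.inl le_rfl)] at h0
  rw [hg.1 1 (Or.inr le_rfl)] at h1
  exact ⟨h0, h1⟩

/-- Since `x₀` is convex on `(0,1)`, its powers have a corner at every point whose orbit meets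
the corner `1/2` of `x₀` in time. -/
lemma x0_pow_corner (n : ℕ) {t : ℝ} (ht : t ∈ Set.Ioo (0 : ℝ) 1) :
    ∃ a b : ℝ, 0 < a ∧ a ≤ b ∧ ((∃ j < n, (x0 ^ j) t = 1 / 2) → a < b) ∧
      HasDerivWithinAt (x0 ^ n : Equiv.Perm ℝ) a (Set.Iic t) t ∧
      HasDerivWithinAt (x0 ^ n : Equiv.Perm ℝ) b (Set.Ici t) t := by
  induction n with
  | zero =>
    refine ⟨1, 1, one_pos, le_rfl, by simp, ?_, ?_⟩ <;> exact (hasDerivAt_id t).hasDerivWithinAt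
  | succ n ih =>
    obtain ⟨a, b, ha, hab, hlt, hl, hr⟩ := ih
    have hy := (memF_x0.pow n).mem_Ioo ht
    have hmono := (memF_x0.pow n).2.1.monotone
    have hL := (x0_hasDerivWithinAt_Iic hy.1 hy.2).comp t hl fun s hs => hmono hs
    have hR := (x0_hasDerivWithinAt_Ici hy.1 hy.2).comp t hr fun s hs => hmono hs
    rw [← Equiv.Perm.coe_mul, ← pow_succ'] at hL hR
    refine ⟨_, _, ?_, ?_, ?_, hL, hR⟩
    · apply mul_pos _ ha
      split_ifs <;> norm_num
    · apply mul_le_mul _ hab ha.le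
      · split_ifs <;> norm_num
      · split_ifs <;> linarith
    · rintro ⟨j, hj, hjt⟩
      rcases Nat.lt_succ_iff_lt_or_eq.1 hj with hj | rfl
      · have := hlt ⟨j, hj, hjt⟩
        split_ifs <;> linarith
      · rw [hjt]
        norm_num
        linarith

lemma not_differentiableAt_x0_pow {n j : ℕ} (hj : j < n) :
    ¬ DifferentiableAt ℝ (x0 ^ n : Equiv.Perm ℝ) ((x0⁻¹ ^ j) (1 / 2)) := by
  intro hd
  obtain ⟨a, b, -, -, hlt, hl, hr⟩ := x0_pow_corner n
    ((memF_x0_inv.pow j).mem_Ioo (t := 1 / 2) (by norm_num))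
  have e1 := (uniqueDiffOn_Iic _ _ Set.self_mem_Iic).eq_deriv _ hl hd.hasDerivAt.hasDerivWithinAt
  have e2 := (uniqueDiffOn_Ici _ _ Set.self_mem_Ici).eq_deriv _ hr hd.hasDerivAt.hasDerivWithinAt
  have := hlt ⟨j, hj, by simp⟩
  linarith

lemma not_differentiableAt_shrinkConj {g : Equiv.Perm ℝ} {t : ℝ}
    (h : ¬ DifferentiableAt ℝ g t) : ¬ DifferentiableAt ℝ (shrinkConj g) (shrink t) := by
  intro hd
  apply h
  have e : (g : ℝ → ℝ) = fun y => 4 * shrinkConj g (1 / 2 + y / 4) - 2 := by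
    ext y
    rw [shrinkConj_apply, show 4 * (1 / 2 + y / 4) - 2 = y by ring]
    ring
  rw [e]
  have hs : DifferentiableAt ℝ (fun y : ℝ => 1 / 2 + y / 4) t := by fun_prop
  have := DifferentiableAt.comp (f := fun y : ℝ => 1 / 2 + y / 4) t hd hs
  exact (this.const_mul 4).sub_const 2

/-! ### Orbits of `x₀` -/

lemma x0_apply_lt {t : ℝ} (ht : t ∈ Set.Ioo (0 : ℝ) 1) : x0 t < t := by
  obtain ⟨h1, h2⟩ := ht
  simp only [x0_apply, x0fun]
  split_ifs <;> linarith

lemma x0_apply_le {t : ℝ} (ht : t ≤ 1) : x0 t ≤ t := by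
  simp only [x0_apply, x0fun]
  split_ifs <;> linarith

lemma lt_x0_inv_apply {t : ℝ} (ht : t ∈ Set.Ioo (0 : ℝ) 1) : t < x0⁻¹ t := by
  simpa using x0_apply_lt (memF_x0_inv.mem_Ioo ht)

lemma strictMono_x0_inv_pow_half : StrictMono fun j : ℕ => (x0⁻¹ ^ j) (1 / 2) := by
  refine strictMono_nat_of_lt_succ fun j => ?_
  rw [pow_succ', Equiv.Perm.mul_apply]
  exact lt_x0_inv_apply ((memF_x0_inv.pow j).mem_Ioo (by norm_num))

lemma x0_pow_le_half {t : ℝ} (h1 : t < 3 / 4) (i : ℕ) :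
    (x0 ^ (i + 1)) t < 1 / 2 := by
  induction i with
  | zero =>
    simp only [zero_add, pow_one, x0_apply, x0fun]
    split_ifs <;> linarith
  | succ i ih =>
    rw [pow_succ', Equiv.Perm.mul_apply]
    exact (x0_apply_le (by linarith)).trans_lt ih

/-- The open fundamental domain `(1/2, 3/4)` of `x₀` is disjoint from all its translates. -/
lemma x0_zpow_fundamental {s t : ℝ} (hs : s ∈ Set.Ioo (1 / 2 : ℝ) (3 / 4))
    (ht : t ∈ Set.Ico (1 / 2 : ℝ) (3 / 4)) {e : ℤ} (h : (x0 ^ e) s = t) : e = 0 := by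
  rcases lt_trichotomy e 0 with he | he | he
  · exfalso
    obtain ⟨i, hi⟩ : ∃ i : ℕ, e = -((i + 1 : ℕ) : ℤ) := ⟨(-e - 1).toNat, by omega⟩
    rw [hi, zpow_neg, zpow_natCast, Equiv.Perm.inv_eq_iff_eq] at h
    have := x0_pow_le_half ht.2 i
    rw [← h] at this
    linarith [hs.1]
  · exact he
  · exfalso
    obtain ⟨i, hi⟩ : ∃ i : ℕ, e = ((i + 1 : ℕ) : ℤ) := ⟨(e - 1).toNat, by omega⟩
    rw [hi, zpow_natCast] at h
    have := x0_pow_le_half hs.2 i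
    rw [h] at this
    linarith [ht.1]

lemma MemF.zpow {g : Equiv.Perm ℝ} (hg : MemF g) (hg' : MemF g⁻¹) (e : ℤ) : MemF (g ^ e) := by
  cases e with
  | ofNat n => simpa using hg.pow n
  | negSucc n => simpa [zpow_negSucc, ← inv_pow] using hg'.pow (n + 1)

/-- The `x₀`-orbit of an interior point of the fundamental domain avoids the corners of `x₀`. -/
lemma x0_zpow_notMem_corners {s : ℝ} (hs : s ∈ Set.Ioo (1 / 2 : ℝ) (3 / 4)) (e : ℤ) :
    (x0 ^ e) s ∉ ({0, 1 / 2, 3 / 4, 1} : Set ℝ) := by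
  have hI := (memF_x0.zpow memF_x0_inv e).mem_Ioo (t := s) ⟨by linarith [hs.1], by linarith [hs.2]⟩
  have key : ∀ e : ℤ, (x0 ^ e) s ≠ 1 / 2 := by
    intro e h
    have := x0_zpow_fundamental hs ⟨le_rfl, by norm_num⟩ h
    rw [this, zpow_zero, Equiv.Perm.one_apply] at h
    linarith [hs.1]
  rintro (h | h | h | h)
  · linarith [hI.1]
  · exact key e h
  · apply key (1 + e)
    rw [zpow_add, zpow_one, Equiv.Perm.mul_apply, h, x0_apply, x0fun]
    norm_num
  · rw [Set.mem_singleton_iff] at h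
    linarith [hI.2]

lemma differentiableAt_x0 {t : ℝ} (ht : t ∉ ({0, 1 / 2, 3 / 4, 1} : Set ℝ)) :
    DifferentiableAt ℝ x0 t := by
  simp only [Set.mem_insert_iff, Set.mem_singleton_iff, not_or] at ht
  obtain ⟨h0, h1, h2, h3⟩ := ht
  rcases lt_or_gt_of_ne h0 with h0 | h0
  · exact differentiableAt_of_affine (l := t - 1) (c := 1) (d := 0) (by linarith) h0 fun s hs => by
      obtain ⟨hs1, hs2⟩ := hs; simp only [x0_apply, x0fun]; split_ifs <;> linarith
  rcases lt_or_gt_of_ne h1 with h1 | h1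
  · exact differentiableAt_of_affine (c := 1 / 2) (d := 0) h0 h1 fun s hs => by
      obtain ⟨hs1, hs2⟩ := hs; simp only [x0_apply, x0fun]; split_ifs <;> linarith
  rcases lt_or_gt_of_ne h2 with h2 | h2
  · exact differentiableAt_of_affine (c := 1) (d := -1 / 4) h1 h2 fun s hs => by
      obtain ⟨hs1, hs2⟩ := hs; simp only [x0_apply, x0fun]; split_ifs <;> linarith
  rcases lt_or_gt_of_ne h3 with h3 | h3
  · exact differentiableAt_of_affine (c := 2) (d := -1) h2 h3 fun s hs => by
      obtain ⟨hs1, hs2⟩ := hs; simp only [x0_apply, x0fun]; split_ifs <;> linarith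
  · exact differentiableAt_of_affine (r := t + 1) (c := 1) (d := 0) h3 (by linarith) fun s hs => by
      obtain ⟨hs1, hs2⟩ := hs; simp only [x0_apply, x0fun]; split_ifs <;> linarith

lemma differentiableAt_x0_inv {t : ℝ} (ht : x0⁻¹ t ∉ ({0, 1 / 2, 3 / 4, 1} : Set ℝ)) :
    DifferentiableAt ℝ (x0⁻¹ : Equiv.Perm ℝ) t := by
  simp only [Set.mem_insert_iff, Set.mem_singleton_iff, not_or, Equiv.Perm.inv_eq_iff_eq,
    x0_apply, x0fun] at ht
  norm_num at ht
  obtain ⟨h0, h1, h2, h3⟩ := ht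
  rcases lt_or_gt_of_ne h0 with h0 | h0
  · exact differentiableAt_of_affine (l := t - 1) (c := 1) (d := 0) (by linarith) h0 fun s hs => by
      obtain ⟨hs1, hs2⟩ := hs; simp only [x0_inv_apply, x0inv]; split_ifs <;> linarith
  rcases lt_or_gt_of_ne h1 with h1 | h1
  · exact differentiableAt_of_affine (c := 2) (d := 0) h0 h1 fun s hs => by
      obtain ⟨hs1, hs2⟩ := hs; simp only [x0_inv_apply, x0inv]; split_ifs <;> linarith
  rcases lt_or_gt_of_ne h2 with h2 | h2
  · exact differentiableAt_of_affine (c := 1) (d := 1 / 4) h1 h2 fun s hs => by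
      obtain ⟨hs1, hs2⟩ := hs; simp only [x0_inv_apply, x0inv]; split_ifs <;> linarith
  rcases lt_or_gt_of_ne h3 with h3 | h3
  · exact differentiableAt_of_affine (c := 1 / 2) (d := 1 / 2) h2 h3 fun s hs => by
      obtain ⟨hs1, hs2⟩ := hs; simp only [x0_inv_apply, x0inv]; split_ifs <;> linarith
  · exact differentiableAt_of_affine (r := t + 1) (c := 1) (d := 0) h3 (by linarith) fun s hs => by
      obtain ⟨hs1, hs2⟩ := hs; simp only [x0_inv_apply, x0inv]; split_ifs <;> linarith

lemma differentiableAt_x0_zpow {t : ℝ}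
    (ht : ∀ e : ℤ, (x0 ^ e) t ∉ ({0, 1 / 2, 3 / 4, 1} : Set ℝ)) (e : ℤ) :
    DifferentiableAt ℝ (x0 ^ e : Equiv.Perm ℝ) t := by
  induction e using Int.induction_on with
  | zero => exact differentiableAt_id
  | succ i ih =>
    rw [add_comm, zpow_add, zpow_one, Equiv.Perm.coe_mul]
    exact (differentiableAt_x0 (ht _)).comp t ih
  | pred i ih =>
    rw [sub_eq_neg_add, zpow_add, zpow_neg_one, Equiv.Perm.coe_mul]
    refine (differentiableAt_x0_inv ?_).comp t ih
    have := ht (-1 + -i)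
    rwa [zpow_add, zpow_neg_one, Equiv.Perm.mul_apply] at this

/-! ### The conjugator: copies of a map of `[1/2, 3/4]` on consecutive fundamental domains -/

/-- The product of the conjugates `x₀ⁱ q x₀⁻ⁱ` for `i < k`. -/
def spread (q : Equiv.Perm ℝ) : ℕ → Equiv.Perm ℝ
  | 0 => 1
  | k + 1 => q * (x0 * spread q k * x0⁻¹)

lemma perm_apply_inv_self (g : Equiv.Perm ℝ) (t : ℝ) : g (g⁻¹ t) = t := g.apply_symm_apply t

lemma perm_inv_apply_self (g : Equiv.Perm ℝ) (t : ℝ) : g⁻¹ (g t) = t := g.symm_apply_apply t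

lemma MemF.spread {q : Equiv.Perm ℝ} (hq : MemF q) (k : ℕ) : MemF (spread q k) := by
  induction k with
  | zero => exact MemF.one
  | succ k ih => exact hq.mul ((memF_x0.mul ih).mul memF_x0_inv)

lemma spread_succ_right (q : Equiv.Perm ℝ) (k : ℕ) :
    spread q (k + 1) = spread q k * (x0 ^ k * q * x0⁻¹ ^ k) := by
  induction k with
  | zero => simp [spread]
  | succ k ih =>
    have e : ∀ j, spread q (j + 1) = q * (x0 * spread q j * x0⁻¹) := fun _ => rfl
    rw [e (k + 1)]
    nth_rewrite 1 [ih]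
    rw [e k, pow_succ', pow_succ]
    group

lemma three_quarters_le_x0_inv {t : ℝ} (ht : 1 / 2 ≤ t) : 3 / 4 ≤ x0⁻¹ t := by
  simp only [x0_inv_apply, x0inv]
  split_ifs <;> linarith

lemma spread_apply_of_three_quarters_le {q : Equiv.Perm ℝ}
    (hq : ∀ t, t ≤ 1 / 2 ∨ 3 / 4 ≤ t → q t = t) (k : ℕ) {t : ℝ} (ht : 3 / 4 ≤ t) :
    spread q k t = t := by
  induction k generalizing t with
  | zero => rfl
  | succ k ih =>
    simp only [spread, Equiv.Perm.mul_apply]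
    rw [ih (three_quarters_le_x0_inv (by linarith)), perm_apply_inv_self, hq t (Or.inr ht)]

lemma spread_conj_apply_of_half_le {q : Equiv.Perm ℝ}
    (hq : ∀ t, t ≤ 1 / 2 ∨ 3 / 4 ≤ t → q t = t) (k : ℕ) {t : ℝ} (ht : 1 / 2 ≤ t) :
    (x0 * spread q k * x0⁻¹) t = t := by
  simp only [Equiv.Perm.mul_apply]
  rw [spread_apply_of_three_quarters_le hq k (three_quarters_le_x0_inv ht),
    perm_apply_inv_self]

lemma commute_spread {q : Equiv.Perm ℝ} (hq : ∀ t, t ≤ 1 / 2 ∨ 3 / 4 ≤ t → q t = t) (k : ℕ) :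
    Commute q (spread q k) := by
  cases k with
  | zero => exact Commute.one_right q
  | succ k =>
    refine (Commute.refl q).mul_right (Equiv.Perm.Disjoint.commute fun t => ?_)
    rcases le_total t (1 / 2) with ht | ht
    · exact Or.inl (hq t (Or.inl ht))
    · exact Or.inr (spread_conj_apply_of_half_le hq k ht)

/-- Conjugating `x₀` by `spread q k` only changes it on two fundamental domains. -/
lemma spread_conj_x0 {q : Equiv.Perm ℝ} (hq : ∀ t, t ≤ 1 / 2 ∨ 3 / 4 ≤ t → q t = t) (k : ℕ) :
    (spread q k)⁻¹ * x0 * spread q k = q⁻¹ * (x0 ^ k * q * x0⁻¹ ^ k) * x0 := by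
  have h1 : x0 * spread q k * x0⁻¹ = q⁻¹ * (spread q k * (x0 ^ k * q * x0⁻¹ ^ k)) := by
    rw [← spread_succ_right, spread, inv_mul_cancel_left]
  have h2 : x0 * spread q k = q⁻¹ * (spread q k * (x0 ^ k * q * x0⁻¹ ^ k)) * x0 := by
    rw [← h1, inv_mul_cancel_right]
  have h3 := ((commute_spread hq k).inv_left).eq
  rw [mul_assoc, h2, ← mul_assoc q⁻¹, h3]
  group

lemma exists_spread_eq_self_near_zero {q : Equiv.Perm ℝ}
    (hq : ∀ t, t ≤ 1 / 2 ∨ 3 / 4 ≤ t → q t = t) (k : ℕ) :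
    ∃ ε : ℝ, 0 < ε ∧ ∀ t < ε, spread q k t = t := by
  induction k with
  | zero => exact ⟨1, one_pos, fun t _ => rfl⟩
  | succ k ih =>
    obtain ⟨ε, hε, h⟩ := ih
    refine ⟨min (x0 ε) (1 / 2), lt_min ?_ (by norm_num), fun t ht => ?_⟩
    · have := x0_strictMono hε
      rwa [memF_x0.1 0 (Or.inl le_rfl)] at this
    · simp only [spread, Equiv.Perm.mul_apply]
      have h1 := strictMono_perm_inv x0_strictMono (ht.trans_le (min_le_left _ _))
      rw [perm_inv_apply_self] at h1
      rw [h _ h1, perm_apply_inv_self]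
      exact hq t (Or.inl (ht.trans_le (min_le_right _ _)).le)

lemma spread_x0_pow_apply {q : Equiv.Perm ℝ} (hq : ∀ t, t ≤ 1 / 2 ∨ 3 / 4 ≤ t → q t = t)
    {k i : ℕ} (hi : i < k) {s : ℝ} (hs : s ∈ Set.Ioo (1 / 2 : ℝ) (3 / 4))
    (hqs : q s < 3 / 4) : spread q k ((x0 ^ i) s) = (x0 ^ i) (q s) := by
  induction k generalizing i with
  | zero => omega
  | succ k ih =>
    cases i with
    | zero =>
      rw [pow_zero, Equiv.Perm.one_apply, Equiv.Perm.one_apply, spread, Equiv.Perm.mul_apply,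
        spread_conj_apply_of_half_le hq k hs.1.le]
    | succ i =>
      simp only [spread, Equiv.Perm.mul_apply]
      rw [pow_succ', Equiv.Perm.mul_apply, perm_inv_apply_self, ih (by omega),
        Equiv.Perm.mul_apply, hq]
      left
      simpa only [pow_succ', Equiv.Perm.mul_apply] using (x0_pow_le_half hqs i).le

/-! ### Rigidity of conjugators -/

lemma x0_pow_apply_of_le_half {t : ℝ} (h0 : 0 ≤ t) (h1 : t ≤ 1 / 2) (n : ℕ) :
    (x0 ^ n) t = t / 2 ^ n := by
  induction n with
  | zero => simp
  | succ n ih =>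
    have hle : t / 2 ^ n ≤ t := div_le_self h0 (one_le_pow₀ one_le_two)
    have hge : 0 ≤ t / 2 ^ n := by positivity
    rw [pow_succ', Equiv.Perm.mul_apply, ih, x0_apply, x0fun, if_neg (by linarith),
      if_pos (by linarith), pow_succ, div_div]

lemma x0_pow_apply_le_half {t : ℝ} {n : ℕ} (h : t ≤ 1 - (1 / 2) ^ (n + 1)) :
    (x0 ^ n) t ≤ 1 / 2 := by
  induction n generalizing t with
  | zero => norm_num at h; simpa using h
  | succ n ih =>
    rw [pow_succ, Equiv.Perm.mul_apply]
    apply ih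
    have h1 : ((1 : ℝ) / 2) ^ (n + 1) ≤ 1 / 2 := pow_le_of_le_one (by norm_num) (by norm_num)
      (by omega)
    rw [pow_succ] at h
    simp only [x0_apply, x0fun]
    split_ifs <;> linarith

/-- Forward orbits of `x₀` in `[0,1)` converge to `0`. -/
lemma exists_x0_pow_lt {t ε : ℝ} (ht : t ∈ Set.Ico (0 : ℝ) 1) (hε : 0 < ε) :
    ∃ n : ℕ, 0 ≤ (x0 ^ n) t ∧ (x0 ^ n) t < ε := by
  obtain ⟨n, hn⟩ := exists_pow_lt_of_lt_one (sub_pos.2 ht.2) (by norm_num : (1 / 2 : ℝ) < 1)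
  obtain ⟨m, hm⟩ := exists_pow_lt_of_lt_one hε (by norm_num : (1 / 2 : ℝ) < 1)
  have hn' : ((1 : ℝ) / 2) ^ (n + 1) ≤ (1 / 2) ^ n :=
    pow_le_pow_of_le_one (by norm_num) (by norm_num) (by omega)
  have h1 : (x0 ^ n) t ≤ 1 / 2 := x0_pow_apply_le_half (by linarith)
  have nonneg : ∀ j : ℕ, 0 ≤ (x0 ^ j) t := fun j => by
    have := (memF_x0.pow j).2.1.monotone ht.1
    rwa [(memF_x0.pow j).1 0 (Or.inl le_rfl)] at this
  refine ⟨m + n, nonneg _, ?_⟩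
  rw [pow_add, Equiv.Perm.mul_apply, x0_pow_apply_of_le_half (nonneg n) h1]
  calc (x0 ^ n) t / 2 ^ m ≤ 1 / 2 ^ m := by gcongr; linarith
    _ = (1 / 2) ^ m := by rw [div_pow, one_pow]
    _ < ε := hm

lemma eq_on_Ico_of_commute_x0 {k : Equiv.Perm ℝ} (hk : Commute k x0) {ε : ℝ} (hε : 0 < ε)
    (h : ∀ t, 0 ≤ t → t < ε → k t = t) {t : ℝ} (ht : t ∈ Set.Ico (0 : ℝ) 1) : k t = t := by
  obtain ⟨n, h0, h1⟩ := exists_x0_pow_lt ht hε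
  have e : k ((x0 ^ n) t) = (x0 ^ n) (k t) := by
    rw [← Equiv.Perm.mul_apply, (hk.pow_right n).eq, Equiv.Perm.mul_apply]
  rw [h _ h0 h1] at e
  exact ((x0 ^ n).injective e).symm

lemma exists_x0_zpow_eq_scaling (m m' : ℕ) :
    ∃ e : ℤ, ∃ ε : ℝ, 0 < ε ∧ ∀ t, 0 ≤ t → t < ε → (x0 ^ e) t = 2 ^ m / 2 ^ m' * t := by
  refine ⟨(m' : ℤ) - m, 1 / 2 / 2 ^ m, by positivity, fun t h0 h1 => ?_⟩
  rw [lt_div_iff₀ (by positivity)] at h1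
  have hpos : (0 : ℝ) < 2 ^ m := by positivity
  have e1 : (x0 ^ m) (2 ^ m * t) = t := by
    rw [x0_pow_apply_of_le_half (by positivity) (by linarith), mul_div_cancel_left₀ _ hpos.ne']
  have e2 : (x0 ^ (-(m : ℤ))) t = 2 ^ m * t := by
    rw [zpow_neg, zpow_natCast, Equiv.Perm.inv_eq_iff_eq, e1]
  rw [sub_eq_add_neg, zpow_add, Equiv.Perm.mul_apply, e2, zpow_natCast,
    x0_pow_apply_of_le_half (by positivity) (by linarith)]
  ring

/-- An element of `V` fixing `0` is a scaling by a power of `2` near `0`. -/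
lemma MemV.exists_scaling_near_zero {h : Equiv.Perm ℝ} (hh : MemV h) (h0 : h 0 = 0) :
    ∃ m m' : ℕ, ∃ ε : ℝ, 0 < ε ∧ ∀ t, 0 ≤ t → t < ε → h t = 2 ^ m / 2 ^ m' * t := by
  obtain ⟨-, N, a, b, σ, a0, a1, -, -, hmono, -, hp⟩ := hh
  cases N with
  | zero =>
    have : (0 : Fin 1) = Fin.last 0 := rfl
    rw [this, a1] at a0
    norm_num at a0
  | succ N =>
    obtain ⟨⟨k, m, hk, hk1⟩, -, c, d, hc, hcd, hl, hr⟩ := hp 0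
    obtain ⟨-, ⟨l, n, hb, hb1⟩, -⟩ := hp (σ 0)
    have hm : (0 : ℝ) < 2 ^ m := by positivity
    have hn : (0 : ℝ) < 2 ^ n := by positivity
    have hlt := hmono (Fin.castSucc_lt_succ (i := (0 : Fin (N + 1))))
    rw [Fin.castSucc_zero, a0] at hk hcd hl hlt
    have hd : d = 0 := by
      have := hcd 0 ⟨le_rfl, hlt⟩
      rw [h0] at this
      linarith
    have hk0 : (k : ℝ) = 0 := by
      rw [eq_div_iff hm.ne'] at hk
      linarith
    have hl0 : (l : ℝ) = 0 := by
      rw [← hl, hd, eq_div_iff hn.ne'] at hb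
      linarith
    have hc' : c = 2 ^ m / 2 ^ n := by
      rw [hb1, hk1, hd, hl0, hk0] at hr
      field_simp at hr ⊢
      linarith
    refine ⟨m, n, _, hlt, fun t ht0 ht1 => ?_⟩
    rw [hcd t ⟨ht0, ht1⟩, hd, hc', add_zero]

lemma MemV.mem_Ico {h : Equiv.Perm ℝ} (hh : MemV h) {t : ℝ} (ht : t ∈ Set.Ico (0 : ℝ) 1) :
    h t ∈ Set.Ico (0 : ℝ) 1 := by
  by_contra hc
  exact hc ((h.injective (hh.1 _ hc)).symm ▸ ht)

/-- Any two conjugators between `x₀` and a conjugate of it differ by a power of `x₀`. -/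
lemma eq_x0_zpow_mul_of_conj_eq {h g : Equiv.Perm ℝ} (hh : MemV h) (hg : MemF g) {ε : ℝ}
    (hε : 0 < ε) (hgε : ∀ t < ε, g t = t) (hc : h⁻¹ * x0 * h = g⁻¹ * x0 * g) :
    ∃ e : ℤ, h = x0 ^ e * g := by
  have hcomm : x0 * (h * g⁻¹) = h * g⁻¹ * x0 := by
    have : x0 * h = h * (g⁻¹ * x0 * g) := by rw [← hc]; group
    rw [← mul_assoc, this]
    group
  have hg0 : g⁻¹ 0 = 0 := by rw [Equiv.Perm.inv_eq_iff_eq, hg.1 0 (Or.inl le_rfl)]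
  have h0 : h 0 = 0 := by
    have hI := hh.mem_Ico (t := 0) ⟨le_rfl, one_pos⟩
    have e := congrArg (fun f : Equiv.Perm ℝ => f 0) hcomm
    simp only [Equiv.Perm.mul_apply, memF_x0.1 0 (Or.inl le_rfl), hg0] at e
    by_contra hne
    exact (x0_apply_lt ⟨lt_of_le_of_ne hI.1 (Ne.symm hne), hI.2⟩).ne e
  obtain ⟨m, m', ε₁, hε₁, h1⟩ := hh.exists_scaling_near_zero h0
  obtain ⟨e, ε₂, hε₂, h2⟩ := exists_x0_zpow_eq_scaling m m'
  have hfix : ∀ t ∈ Set.Ico (0 : ℝ) 1, ((x0 ^ e)⁻¹ * (h * g⁻¹)) t = t := by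
    intro t ht
    refine eq_on_Ico_of_commute_x0 (ε := min ε (min ε₁ ε₂)) ?_
      (lt_min hε (lt_min hε₁ hε₂)) (fun s hs0 hs => ?_) ht
    · exact ((Commute.refl x0).zpow_left e).inv_left.mul_left hcomm.symm
    · simp only [lt_min_iff] at hs
      have hgs : g⁻¹ s = s := by rw [Equiv.Perm.inv_eq_iff_eq, hgε s hs.1]
      rw [Equiv.Perm.mul_apply, Equiv.Perm.mul_apply, hgs, Equiv.Perm.inv_eq_iff_eq,
        h1 s hs0 hs.2.1, h2 s hs0 hs.2.2]
  refine ⟨e, ?_⟩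
  have key : (x0 ^ e)⁻¹ * (h * g⁻¹) = 1 := by
    ext t
    by_cases ht : t ∈ Set.Ico (0 : ℝ) 1
    · exact hfix t ht
    · have hx := (memF_x0.zpow memF_x0_inv e).memT.1.1 t ht
      have hgt := hg.memT.1.1 t ht
      rw [Equiv.Perm.mul_apply, Equiv.Perm.mul_apply, Equiv.Perm.one_apply,
        Equiv.Perm.inv_eq_iff_eq.2 hgt.symm, hh.1 t ht, Equiv.Perm.inv_eq_iff_eq, hx]
  rw [inv_mul_eq_one] at key
  rw [key]
  group

/-! ### Counting corners -/

/-- The set of points where a permutation of `ℝ` is not differentiable. -/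
def corners (g : Equiv.Perm ℝ) : Set ℝ := {t | ¬ DifferentiableAt ℝ g t}

lemma exists_piece {N : ℕ} {a : Fin (N + 1) → ℝ} {t : ℝ} (h0 : a 0 ≤ t)
    (h1 : t < a (Fin.last N)) : ∃ i : Fin N, a i.castSucc ≤ t ∧ t < a i.succ := by
  by_contra hc
  push Not at hc
  have : ∀ i, a i ≤ t := fun i => Fin.induction h0 (fun i hi => hc i hi) i
  linarith [this (Fin.last N)]

lemma MemV.finite_corners {v : Equiv.Perm ℝ} (hv : MemV v) : (corners v).Finite := by
  obtain ⟨h0, N, a, b, σ, a0, a1, -, -, -, -, hp⟩ := hv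
  refine (Set.finite_range a).subset fun t ht => ?_
  by_contra hr
  apply ht
  have hne : ∀ i, a i ≠ t := fun i hi => hr ⟨i, hi⟩
  have ht0 := hne 0
  have ht1 := hne (Fin.last N)
  rw [a0] at ht0
  rw [a1] at ht1
  rcases lt_or_gt_of_ne ht0 with h | h
  · rcases lt_or_gt_of_ne ht1 with h' | h'
    · refine differentiableAt_of_affine (r := t + 1) (c := 1) (d := 0) h' (by linarith)
        fun s hs => ?_
      rw [h0 s fun hI => by linarith [hI.2, hs.1]]
      ring
    · obtain ⟨i, hi, hi'⟩ := exists_piece (a := a) (t := t) (by rw [a0]; exact h.le) (by rw [a1]; exact h')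
      obtain ⟨-, -, c, d, -, hcd, -⟩ := hp i
      exact differentiableAt_of_affine (lt_of_le_of_ne hi (hne _)) hi'
        fun s hs => hcd s ⟨hs.1.le, hs.2⟩
  · refine differentiableAt_of_affine (l := t - 1) (c := 1) (d := 0) (by linarith) h
      fun s hs => ?_
    rw [h0 s fun hI => by linarith [hI.1, hs.2]]
    ring

lemma MemV.inv {v : Equiv.Perm ℝ} (hv : MemV v) : MemV v⁻¹ := by
  obtain ⟨h0, N, a, b, σ, a0, a1, b0, b1, ha, hb, hp⟩ := hv
  refine ⟨fun t ht => ?_, N, b, a, σ⁻¹, b0, b1, a0, a1, hb, ha, fun j => ?_⟩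
  · rw [Equiv.Perm.inv_eq_iff_eq, h0 t ht]
  · obtain ⟨i, rfl⟩ := σ.surjective j
    have hσ : σ⁻¹ (σ i) = i := σ.symm_apply_apply i
    obtain ⟨-, -, c, d, hc, hcd, hl, hr⟩ := hp i
    rw [hσ]
    refine ⟨(hp (σ i)).2.1, (hp (σ i)).1, c⁻¹, -d / c, inv_pos.2 hc, fun t ht => ?_, ?_, ?_⟩
    · rw [← hl, ← hr] at ht
      rw [Equiv.Perm.inv_eq_iff_eq, hcd]
      · field_simp
        ring
      · constructor
        · rw [inv_mul_eq_div, ← add_div, le_div_iff₀ hc]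
          linarith [ht.1]
        · rw [inv_mul_eq_div, ← add_div, div_lt_iff₀ hc]
          linarith [ht.2]
    · rw [← hl]
      field_simp
      ring
    · rw [← hr]
      field_simp
      ring

lemma encard_corners_mul_le (g h : Equiv.Perm ℝ) :
    (corners (g * h)).encard ≤ (corners g).encard + (corners h).encard := by
  have hsub : corners (g * h) ⊆ h ⁻¹' corners g ∪ corners h := by
    intro t ht
    by_contra hc
    simp only [corners, Set.mem_union, Set.mem_preimage, Set.mem_ofPred_eq, not_or, not_not] at hc
    exact ht (hc.1.comp t hc.2)
  refine (Set.encard_le_encard hsub).trans ((Set.encard_union_le _ _).trans ?_)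
  rw [Set.encard_preimage_of_bijective h.bijective]

lemma encard_corners_prod_le {K : ℕ} {w : List (Equiv.Perm ℝ)}
    (hw : ∀ g ∈ w, (corners g).encard ≤ K) :
    (corners w.prod).encard ≤ ((w.length * K : ℕ) : ℕ∞) := by
  induction w with
  | nil =>
    have : corners 1 = ∅ := by
      ext t
      simp [corners]
    simp [this]
  | cons g w ih =>
    rw [List.prod_cons]
    refine (encard_corners_mul_le _ _).trans ?_
    rw [List.length_cons, add_mul, one_mul, add_comm, Nat.cast_add]
    exact add_le_add (ih fun g' hg' => hw g' (List.mem_cons_of_mem _ hg')) (hw g List.mem_cons_self)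

/-- Every conjugator in the `n`-th family has at least `n²` corners. -/
lemma sq_le_encard_corners (n : ℕ) (e : ℤ) :
    ((n * n : ℕ) : ℕ∞) ≤ (corners (x0 ^ e * spread (shrinkConj x0 ^ n) n)).encard := by
  have hqF := memF_x0.pow n
  have hq : ∀ t, t ≤ 1 / 2 ∨ 3 / 4 ≤ t → (shrinkConj x0 ^ n) t = t := fun t ht => by
    rw [shrinkConj_pow]
    exact hqF.shrinkConj_apply_of_le ht
  have hqI : ∀ s ∈ Set.Ioo (1 / 2 : ℝ) (3 / 4),
      (shrinkConj x0 ^ n) s ∈ Set.Ioo (1 / 2 : ℝ) (3 / 4) := fun s hs => by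
    have := hqF.mem_Ioo (t := 4 * s - 2) ⟨by linarith [hs.1], by linarith [hs.2]⟩
    rw [shrinkConj_pow, shrinkConj_apply]
    exact ⟨by linarith [this.1], by linarith [this.2]⟩
  set q := shrinkConj x0 ^ n with hqdef
  set β : ℕ → ℝ := fun j => shrink ((x0⁻¹ ^ j) (1 / 2)) with hβ
  have hβI : ∀ j, β j ∈ Set.Ioo (1 / 2 : ℝ) (3 / 4) := fun j => by
    have := (memF_x0_inv.pow j).mem_Ioo (t := 1 / 2) (by norm_num)
    rw [hβ]
    dsimp only
    rw [shrink_apply]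
    exact ⟨by linarith [this.1], by linarith [this.2]⟩
  have hβq : ∀ j < n, ¬ DifferentiableAt ℝ q (β j) := fun j hj => by
    rw [hqdef, shrinkConj_pow]
    exact not_differentiableAt_shrinkConj (not_differentiableAt_x0_pow hj)
  let φ : Fin n × Fin n → ℝ := fun x => (x0 ^ (x.1 : ℕ)) (β x.2)
  have hφ : Function.Injective φ := by
    rintro ⟨i, j⟩ ⟨i', j'⟩ h
    have h' : (x0 ^ (i : ℕ)) (β j) = (x0 ^ (i' : ℕ)) (β j') := h
    have h2 : (x0 ^ (-((i' : ℕ) : ℤ) + (i : ℕ))) (β j) = β j' := by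
      rw [zpow_add, Equiv.Perm.mul_apply, zpow_natCast, h', zpow_neg, zpow_natCast,
        perm_inv_apply_self]
    have h3 := x0_zpow_fundamental (hβI j) (Set.Ioo_subset_Ico_self (hβI j')) h2
    have hii : i = i' := Fin.ext (by omega)
    subst hii
    have h4 := shrink.injective ((x0 ^ (i : ℕ)).injective h')
    have h5 := strictMono_x0_inv_pow_half.injective h4
    rw [Fin.ext h5]
  have hrange : Set.range φ ⊆ corners (x0 ^ e * spread q n) := by
    rintro _ ⟨⟨i, j⟩, rfl⟩ hd
    refine hβq j j.2 ?_
    have hval : ∀ s ∈ Set.Ioo (1 / 2 : ℝ) (3 / 4),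
        (x0 ^ e * spread q n) ((x0 ^ (i : ℕ)) s) = (x0 ^ (e + (i : ℕ))) (q s) := fun s hs => by
      rw [Equiv.Perm.mul_apply, spread_x0_pow_apply hq i.2 hs (hqI s hs).2, zpow_add,
        zpow_natCast, Equiv.Perm.mul_apply]
    have d1 : DifferentiableAt ℝ (x0 ^ (i : ℕ) : Equiv.Perm ℝ) (β j) := by
      have := differentiableAt_x0_zpow (x0_zpow_notMem_corners (hβI j)) (i : ℕ)
      rwa [zpow_natCast] at this
    have d2 := DifferentiableAt.comp (β j) hd d1
    have d3 : DifferentiableAt ℝ (x0 ^ (-(e + (i : ℕ))) : Equiv.Perm ℝ)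
        (((x0 ^ e * spread q n : Equiv.Perm ℝ) ∘ (x0 ^ (i : ℕ) : Equiv.Perm ℝ)) (β j)) := by
      rw [Function.comp_apply, hval _ (hβI j)]
      apply differentiableAt_x0_zpow
      intro e'
      rw [← Equiv.Perm.mul_apply, ← zpow_add]
      exact x0_zpow_notMem_corners (hqI _ (hβI j)) _
    refine (d3.comp (β j) d2).congr_of_eventuallyEq ?_
    filter_upwards [Ioo_mem_nhds (hβI j).1 (hβI j).2] with s hs
    rw [Function.comp_apply, Function.comp_apply, hval s hs, zpow_neg, perm_inv_apply_self]
  calc ((n * n : ℕ) : ℕ∞) = (Set.range φ).encard := by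
        rw [← Set.image_univ, hφ.encard_image, Set.encard_univ]
        simp
    _ ≤ _ := Set.encard_le_encard hrange

/-! ### Word length -/

/-- `g` is a product of at most `n` elements of `S ∪ S⁻¹`. -/
def WordLe (S : Set (Equiv.Perm ℝ)) (g : Equiv.Perm ℝ) (n : ℕ) : Prop :=
  ∃ w : List (Equiv.Perm ℝ), w.length ≤ n ∧ (∀ x ∈ w, x ∈ S ∨ x⁻¹ ∈ S) ∧ w.prod = g

section WordLe

variable {S : Set (Equiv.Perm ℝ)} {g h : Equiv.Perm ℝ} {m n : ℕ}

lemma WordLe.mul (hg : WordLe S g m) (hh : WordLe S h n) : WordLe S (g * h) (m + n) := by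
  obtain ⟨w, h1, h2, rfl⟩ := hg
  obtain ⟨w', h1', h2', rfl⟩ := hh
  refine ⟨w ++ w', by rw [List.length_append]; omega, fun x hx => ?_, List.prod_append⟩
  rcases List.mem_append.1 hx with hx | hx
  · exact h2 x hx
  · exact h2' x hx

lemma WordLe.inv (hg : WordLe S g m) : WordLe S g⁻¹ m := by
  obtain ⟨w, h1, h2, rfl⟩ := hg
  refine ⟨(w.map (·⁻¹)).reverse, by simpa using h1, fun x hx => ?_,
    (List.prod_inv_reverse w).symm⟩
  simp only [List.mem_reverse, List.mem_map] at hx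
  obtain ⟨y, hy, rfl⟩ := hx
  rw [inv_inv]
  exact (h2 y hy).symm

lemma WordLe.pow (hg : WordLe S g m) (n : ℕ) : WordLe S (g ^ n) (n * m) := by
  induction n with
  | zero => exact ⟨[], by simp, by simp, by simp⟩
  | succ n ih =>
    rw [pow_succ, add_mul, one_mul]
    exact ih.mul hg

lemma WordLe.wordLengthWith_le (hg : WordLe S g m) : wordLengthWith S g ≤ m := by
  obtain ⟨w, h1, h2, h3⟩ := hg
  have : wordLengthWith S g ≤ w.length := Nat.sInf_le ⟨w, rfl, h2, h3⟩
  exact this.trans h1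

lemma exists_minimal_word (hS : GeneratesT S) (hg : MemT g) :
    ∃ w : List (Equiv.Perm ℝ), w.length = wordLengthWith S g ∧
      (∀ x ∈ w, x ∈ S ∨ x⁻¹ ∈ S) ∧ w.prod = g := by
  obtain ⟨w, h1, h2⟩ := hS.2.2 g hg
  exact Nat.sInf_mem (s := {n | ∃ w : List (Equiv.Perm ℝ), w.length = n ∧
    (∀ g ∈ w, g ∈ S ∨ g⁻¹ ∈ S) ∧ w.prod = g}) ⟨w.length, w, rfl, h1, h2⟩

lemma wordLe_wordLengthWith (hS : GeneratesT S) (hg : MemT g) :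
    WordLe S g (wordLengthWith S g) := by
  obtain ⟨w, h1, h2, h3⟩ := exists_minimal_word hS hg
  exact ⟨w, h1.le, h2, h3⟩

lemma finite_letters (hS : S.Finite) : {x | x ∈ S ∨ x⁻¹ ∈ S}.Finite :=
  hS.union (hS.preimage inv_injective.injOn)

lemma finite_wordLe (hS : S.Finite) (n : ℕ) : {g | WordLe S g n}.Finite := by
  induction n with
  | zero =>
    refine (Set.finite_singleton 1).subset ?_
    rintro g ⟨w, h1, -, rfl⟩
    rw [List.length_eq_zero_iff.1 (Nat.le_zero.1 h1)]
    rfl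
  | succ n ih =>
    refine ((Set.finite_singleton 1).union ((finite_letters hS).image2 (· * ·) ih)).subset ?_
    rintro g ⟨w, h1, h2, rfl⟩
    cases w with
    | nil => exact Or.inl rfl
    | cons x w =>
      refine Or.inr ⟨x, h2 x List.mem_cons_self, w.prod, ⟨w, by simpa using h1, fun y hy =>
        h2 y (List.mem_cons_of_mem _ hy), rfl⟩, List.prod_cons.symm⟩

/-- The number of corners is bounded linearly by the word length. -/
lemma exists_encard_corners_le (hS : GeneratesT S) :
    ∃ K : ℕ, ∀ g, MemT g → (corners g).encard ≤ ((wordLengthWith S g * K : ℕ) : ℕ∞) := by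
  have hV : ∀ x, x ∈ S ∨ x⁻¹ ∈ S → MemV x := by
    rintro x (hx | hx)
    · exact (hS.2.1 x hx).1
    · simpa using (hS.2.1 _ hx).1.inv
  obtain ⟨K, hK⟩ := ((finite_letters hS.1).image fun g => (corners g).ncard).bddAbove
  refine ⟨K, fun g hg => ?_⟩
  obtain ⟨w, h1, h2, rfl⟩ := exists_minimal_word hS hg
  rw [← h1]
  refine encard_corners_prod_le fun x hx => ?_
  rw [← (hV x (h2 x hx)).finite_corners.cast_ncard_eq]
  exact_mod_cast hK ⟨x, h2 x hx, rfl⟩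

end WordLe

lemma le_CLFT {S : Set (Equiv.Perm ℝ)} (hS : GeneratesT S) {n : ℕ} {u v : Equiv.Perm ℝ}
    (hu : MemT u) (hv : MemT v) (hc : ∃ h, MemT h ∧ h⁻¹ * u * h = v)
    (hn : wordLengthWith S u + wordLengthWith S v ≤ n) : conjDistT S u v ≤ CLFT S n := by
  refine le_csSup (Set.Finite.bddAbove ?_) ⟨u, v, hu, hv, hc, hn, rfl⟩
  refine ((finite_wordLe hS.1 n).image2 (conjDistT S) (finite_wordLe hS.1 n)).subset ?_
  rintro m ⟨u, v, hu, hv, -, hn, rfl⟩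
  have key : ∀ g, MemT g → wordLengthWith S g ≤ n → WordLe S g n := fun g hg hle => by
    obtain ⟨w, h1, h2, h3⟩ := wordLe_wordLengthWith hS hg
    exact ⟨w, h1.trans hle, h2, h3⟩
  exact ⟨u, key u hu (by omega), v, key v hv (by omega), rfl⟩

lemma exists_conjDistT_eq {S : Set (Equiv.Perm ℝ)} {u v : Equiv.Perm ℝ}
    (hc : ∃ h, MemT h ∧ h⁻¹ * u * h = v) :
    ∃ h, MemT h ∧ h⁻¹ * u * h = v ∧ wordLengthWith S h = conjDistT S u v := by
  obtain ⟨h, h1, h2⟩ := hc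
  exact Nat.sInf_mem (s := {n | ∃ h, MemT h ∧ h⁻¹ * u * h = v ∧ wordLengthWith S h = n})
    ⟨_, h, h1, h2, rfl⟩

/-- Conjugate elements of length `O(m)` all of whose conjugators have length `Ω(m²)`. -/
lemma exists_pair_far_apart {S : Set (Equiv.Perm ℝ)} (hS : GeneratesT S) :
    ∃ K L : ℕ, ∀ m : ℕ, 1 ≤ m → ∃ u v : Equiv.Perm ℝ, MemT u ∧ MemT v ∧
      (∃ h, MemT h ∧ h⁻¹ * u * h = v) ∧ wordLengthWith S u + wordLengthWith S v ≤ L * m ∧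
      ∀ h, MemT h → h⁻¹ * u * h = v → m * m ≤ wordLengthWith S h * K := by
  obtain ⟨K, hK⟩ := exists_encard_corners_le hS
  have hp := memF_x0.shrinkConj
  have hp' : MemF (shrinkConj x0)⁻¹ := by
    rw [← shrinkConj_inv]
    exact memF_x0_inv.shrinkConj
  have wf := wordLe_wordLengthWith hS memF_x0.memT
  have wp := wordLe_wordLengthWith hS hp.memT
  set A := wordLengthWith S x0
  set B := wordLengthWith S (shrinkConj x0)
  refine ⟨K, 4 * A + 2 * B, fun m hm => ?_⟩
  have hq : ∀ t, t ≤ 1 / 2 ∨ 3 / 4 ≤ t → (shrinkConj x0 ^ m) t = t := fun t ht => by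
    rw [shrinkConj_pow]
    exact (memF_x0.pow m).shrinkConj_apply_of_le ht
  have hq' : MemF (shrinkConj x0 ^ m)⁻¹ := by
    rw [← inv_pow]
    exact hp'.pow m
  have hH := (hp.pow m).spread m
  obtain ⟨ε, hε, hHε⟩ := exists_spread_eq_self_near_zero hq m
  have hv := spread_conj_x0 hq m
  refine ⟨x0, (spread (shrinkConj x0 ^ m) m)⁻¹ * x0 * spread (shrinkConj x0 ^ m) m,
    memF_x0.memT, ?_, ⟨_, hH.memT, rfl⟩, ?_, fun h hh hc => ?_⟩
  · rw [hv]
    exact ((hq'.mul (((memF_x0.pow m).mul (hp.pow m)).mul (memF_x0_inv.pow m))).mul memF_x0).memT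
  · rw [hv]
    have := (((wp.pow m).inv.mul (((wf.pow m).mul (wp.pow m)).mul (wf.inv.pow m))).mul
      wf).wordLengthWith_le
    nlinarith
  · obtain ⟨e, rfl⟩ := eq_x0_zpow_mul_of_conj_eq hh.1 hH hε hHε hc
    exact_mod_cast (sq_le_encard_corners m e).trans (hK _ hh)

theorem clfT_quadratic_lower_bound (S : Set (Equiv.Perm ℝ)) (hS : GeneratesT S) :
    ∃ C : ℝ, 0 < C ∧ ∃ N : ℕ, ∀ n : ℕ, N ≤ n →
      (∃ u v : Equiv.Perm ℝ, MemT u ∧ MemT v ∧ (∃ h, MemT h ∧ h⁻¹ * u * h = v) ∧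
        wordLengthWith S u + wordLengthWith S v ≤ n ∧
        ∀ h, MemT h → h⁻¹ * u * h = v → C * (n : ℝ) ^ 2 ≤ (wordLengthWith S h : ℝ)) ∧
      C * (n : ℝ) ^ 2 ≤ (CLFT S n : ℝ) := by
  obtain ⟨K, L, hKL⟩ := exists_pair_far_apart hS
  refine ⟨1 / (4 * (L + 1) ^ 2 * (K + 1)), by positivity, 2 * (L + 1), fun n hn => ?_⟩
  have hm : 2 ≤ n / (L + 1) := (Nat.le_div_iff_mul_le (by omega)).2 hn
  obtain ⟨u, v, hu, hv, hc, hlen, hlow⟩ := hKL (n / (L + 1)) (by omega)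
  have hn' : n ≤ 2 * (L + 1) * (n / (L + 1)) := by
    have h1 := Nat.div_add_mod n (L + 1)
    have h2 := Nat.mod_lt n (by omega : 0 < L + 1)
    nlinarith
  have hlen' : wordLengthWith S u + wordLengthWith S v ≤ n := by
    have h1 := Nat.mul_div_le n (L + 1)
    nlinarith
  have hbound : ∀ h, MemT h → h⁻¹ * u * h = v →
      1 / (4 * (L + 1 : ℝ) ^ 2 * (K + 1)) * (n : ℝ) ^ 2 ≤ wordLengthWith S h := by
    intro h hh hconj
    have h1 : ((n / (L + 1) : ℕ) : ℝ) * (n / (L + 1) : ℕ) ≤ wordLengthWith S h * K := by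
      exact_mod_cast hlow h hh hconj
    have h2 : (n : ℝ) ≤ 2 * (L + 1) * (n / (L + 1) : ℕ) := by exact_mod_cast hn'
    rw [one_div_mul_eq_div, div_le_iff₀ (by positivity)]
    calc (n : ℝ) ^ 2 ≤ (2 * (L + 1) * (n / (L + 1) : ℕ)) ^ 2 := by gcongr
      _ = 4 * (L + 1) ^ 2 * (((n / (L + 1) : ℕ) : ℝ) * (n / (L + 1) : ℕ)) := by ring
      _ ≤ 4 * (L + 1) ^ 2 * (wordLengthWith S h * (K + 1)) := by
        refine mul_le_mul_of_nonneg_left (h1.trans ?_) (by positivity)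
        gcongr
        linarith
      _ = _ := by ring
  refine ⟨⟨u, v, hu, hv, hc, hlen', hbound⟩, ?_⟩
  obtain ⟨h, h1, h2, h3⟩ := exists_conjDistT_eq (S := S) hc
  refine (hbound h h1 h2).trans ?_
  rw [h3]
  exact_mod_cast le_CLFT hS hu hv hc hlen'

end
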